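/- Let d ≥ 3 and let X = (Fin d → ℝ) and Y = (Fin d → ℝ) carry 1-unconditional, strictly monotone norms, both one-p-convex for some 2 < p < ∞, and let U : X → Y be a surjective linear isometry. For an index m let H_m = {x ∈ X : x m = 0}. Suppose k ≠ l are indices and g, h are nonzero linear functionals on Y with U(H_k) = ker g and U(H_l) = ker h. If the support of g (the set {ν : g(f_ν) ≠ 0}) has exactly two elements and supp h ∩ supp g ≠ ∅, then supp h ⊆ supp g. -/

import Mathlib

lemma aux_coord (p : ℝ) (hp : 2 < p) (a b : ℝ) :
    Real.sqrt (a ^ 2 + b ^ 2) ≤ ((|a + b| ^ p + |a - b| ^ p) / 2) ^ (1 / p) := by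
  have hp0 : 0 < p := by linarith
  have hcv : ConvexOn ℝ (Set.Ici 0) (fun x : ℝ => x ^ (p / 2)) := convexOn_rpow (by linarith)
  have m1 : |a + b| ^ 2 ∈ Set.Ici (0 : ℝ) := Set.mem_Ici.2 (by positivity)
  have m2 : |a - b| ^ 2 ∈ Set.Ici (0 : ℝ) := Set.mem_Ici.2 (by positivity)
  have h1 := hcv.2 m1 m2 (by norm_num : (0 : ℝ) ≤ 1 / 2) (by norm_num : (0 : ℝ) ≤ 1 / 2)
    (by norm_num)
  have e : ∀ x : ℝ, 0 ≤ x → (x ^ 2) ^ (p / 2) = x ^ p := by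
    intro x hx
    rw [← Real.rpow_natCast, ← Real.rpow_mul hx]
    congr 1
    push_cast
    ring
  simp only [smul_eq_mul] at h1
  rw [e _ (abs_nonneg _), e _ (abs_nonneg _), sq_abs, sq_abs] at h1
  have h2 : 1 / 2 * (a + b) ^ 2 + 1 / 2 * (a - b) ^ 2 = Real.sqrt (a ^ 2 + b ^ 2) ^ 2 := by
    rw [Real.sq_sqrt (by positivity)]; ring
  rw [h2, e _ (Real.sqrt_nonneg _)] at h1
  calc Real.sqrt (a ^ 2 + b ^ 2) = (Real.sqrt (a ^ 2 + b ^ 2) ^ p) ^ (1 / p) := by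
        rw [one_div, Real.rpow_rpow_inv (Real.sqrt_nonneg _) hp0.ne']
    _ ≤ _ := by
        apply Real.rpow_le_rpow (by positivity) _ (by positivity)
        linarith

lemma aux_disj (d : ℕ) (N : (Fin d → ℝ) → ℝ)
    (hadd : ∀ x y, N (x + y) ≤ N x + N y)
    (hsmul : ∀ (c : ℝ) (x), N (c • x) = |c| * N x)
    (huncond : ∀ x y : Fin d → ℝ, (∀ i, |x i| ≤ |y i|) → N x ≤ N y)
    (hstrict : ∀ x y : Fin d → ℝ, (∀ i, |x i| ≤ |y i|) →
      (∃ i, |x i| < |y i|) → N x < N y)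
    (p : ℝ) (hp : 2 < p)
    (hpconv : ∀ (m : ℕ) (xs : Fin m → (Fin d → ℝ)),
      N (fun i => (∑ j, |xs j i| ^ p) ^ (1 / p)) ≤
        (∑ j, N (xs j) ^ p) ^ (1 / p))
    (z y : Fin d → ℝ) (C : ℝ)
    (h1 : ∀ t : ℝ, 0 < t → N (z + t • y) ^ p ≤ N z ^ p + t ^ p * C)
    (h2 : ∀ t : ℝ, 0 < t → N (z - t • y) ^ p ≤ N z ^ p + t ^ p * C)
    (i : Fin d) : z i = 0 ∨ y i = 0 := by
  by_contra hcon
  push Not at hcon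
  obtain ⟨hz, hy⟩ := hcon
  have hp0 : 0 < p := by linarith
  have hN0 : N 0 = 0 := by have := hsmul 0 0; simpa using this
  have hNn : ∀ x, 0 ≤ N x := fun x => by
    rw [← hN0]; exact huncond _ _ (by simp)
  set a := |z i| with ha
  have hapos : 0 < a := abs_pos.2 hz
  -- the vector |z| and z with coordinate i removed
  set w : Fin d → ℝ := fun j => |z j| with hw
  set w0 : Fin d → ℝ := Function.update w i 0 with hw0
  have hNw : N w = N z := le_antisymm (huncond _ _ (by simp [hw])) (huncond _ _ (by simp [hw]))
  have hlt : N w0 < N z := by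
    rw [← hNw]
    apply hstrict
    · intro j
      by_cases hj : j = i
      · subst hj; simp [hw0]
      · simp [hw0, hj]
    · exact ⟨i, by simp [hw0, hw, hz]⟩
  set Δ := N z - N w0 with hΔ
  have hΔpos : 0 < Δ := by linarith
  have hzpos : 0 < N z := lt_of_le_of_lt (hNn w0) hlt
  have hstep : ∀ s : ℝ, 0 ≤ s → N z + s * (Δ / a) ≤ N (Function.update w i (a + s)) := by
    intro s hs
    have e : (a + s) • w = a • Function.update w i (a + s) + s • w0 := by
      funext j
      by_cases hj : j = i
      · subst hj; simp [hw0, hw, ha]; ring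
      · simp [hw0, hj]; ring
    have := hadd (a • Function.update w i (a + s)) (s • w0)
    rw [← e, hsmul, hsmul, hsmul, hNw, abs_of_nonneg hs, abs_of_pos hapos,
      abs_of_pos (by linarith : 0 < a + s)] at this
    have h3 : a * (N z + s * (Δ / a)) ≤ a * N (Function.update w i (a + s)) := by
      have : a * (N z + s * (Δ / a)) = a * N z + s * Δ := by field_simp
      rw [this, hΔ]; nlinarith
    exact le_of_mul_le_mul_left h3 hapos
  have hmain : ∀ t : ℝ, 0 < t →
      N (fun j => Real.sqrt (z j ^ 2 + (t * y j) ^ 2)) ^ p ≤ N z ^ p + t ^ p * C := by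
    intro t ht
    have hc := hpconv 2 ![z + t • y, z - t • y]
    simp only [Fin.sum_univ_two, Matrix.cons_val_zero, Matrix.cons_val_one, Pi.add_apply,
      Pi.sub_apply, Pi.smul_apply, smul_eq_mul] at hc
    have hk : N (((2:ℝ) ^ (1 / p)) • (fun j => Real.sqrt (z j ^ 2 + (t * y j) ^ 2))) ≤
        N (fun i => (|z i + t * y i| ^ p + |z i - t * y i| ^ p) ^ (1 / p)) := by
      apply huncond
      intro j
      have hj := aux_coord p hp (z j) (t * y j)
      rw [Real.div_rpow (by positivity) (by norm_num), le_div_iff₀ (by positivity)] at hj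
      simp only [Pi.smul_apply, smul_eq_mul]
      rw [abs_of_nonneg (by positivity), abs_of_nonneg (by positivity)]
      linarith
    rw [hsmul, abs_of_pos (by positivity)] at hk
    have hk2 := hk.trans hc
    have hk3 := Real.rpow_le_rpow (mul_nonneg (by positivity) (hNn _)) hk2 hp0.le
    have p1 := Real.rpow_nonneg (hNn (z + t • y)) p
    have p2 := Real.rpow_nonneg (hNn (z - t • y)) p
    rw [Real.mul_rpow (by positivity) (hNn _), one_div, Real.rpow_inv_rpow (by norm_num) hp0.ne',
      Real.rpow_inv_rpow (by linarith) hp0.ne'] at hk3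
    have := h1 t ht
    have := h2 t ht
    linarith
  -- c
  obtain ⟨c, hcpos, hc⟩ : ∃ c : ℝ, 0 < c ∧ 2 * a * c + c ^ 2 ≤ y i ^ 2 := by
    have hy2 : 0 < y i ^ 2 := by positivity
    refine ⟨min 1 (y i ^ 2 / (2 * a + 1)), by positivity, ?_⟩
    set c := min 1 (y i ^ 2 / (2 * a + 1)) with hcdef
    have hc0 : 0 < c := by positivity
    have hc1 : c ≤ 1 := min_le_left _ _
    have hc2 : c ≤ y i ^ 2 / (2 * a + 1) := min_le_right _ _
    rw [le_div_iff₀ (by positivity)] at hc2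
    nlinarith
  set K := N z ^ p * (p * (c * (Δ / a) / N z)) with hK
  have hKpos : 0 < K := by positivity
  have hfin : ∀ t : ℝ, 0 < t → t ≤ 1 → K ≤ t ^ (p - 2) * C := by
    intro t ht ht1
    have hA : N (Function.update w i (a + c * t ^ 2)) ≤
        N (fun j => Real.sqrt (z j ^ 2 + (t * y j) ^ 2)) := by
      apply huncond
      intro j
      rw [abs_of_nonneg (Real.sqrt_nonneg _)]
      by_cases hj : j = i
      · subst hj
        simp only [Function.update_self]
        rw [abs_of_nonneg (by positivity)]
        apply Real.le_sqrt_of_sq_le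
        have e1 : z j ^ 2 = a ^ 2 := by rw [ha, sq_abs]
        rw [e1]
        have e2 : t ^ 4 ≤ t ^ 2 := pow_le_pow_of_le_one ht.le ht1 (by norm_num)
        have e3 : t ^ 2 * (2 * a * c + c ^ 2) ≤ t ^ 2 * y j ^ 2 :=
          mul_le_mul_of_nonneg_left hc (by positivity)
        have e4 : c ^ 2 * t ^ 4 ≤ c ^ 2 * t ^ 2 := mul_le_mul_of_nonneg_left e2 (by positivity)
        nlinarith
      · simp only [Function.update_of_ne hj, hw, abs_abs]
        apply Real.le_sqrt_of_sq_le
        rw [sq_abs]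
        nlinarith [sq_nonneg (t * y j)]
    have hB := (hstep (c * t ^ 2) (by positivity)).trans hA
    have hB2 := (Real.rpow_le_rpow (by positivity) hB hp0.le).trans (hmain t ht)
    have e5 : N z + c * t ^ 2 * (Δ / a) = N z * (1 + c * t ^ 2 * (Δ / a) / N z) := by
      field_simp
    rw [e5, Real.mul_rpow hzpos.le (by positivity)] at hB2
    have hbern := one_add_mul_self_le_rpow_one_add
      (s := c * t ^ 2 * (Δ / a) / N z) (by linarith [show 0 < c * t ^ 2 * (Δ / a) / N z by positivity])
      (p := p) (by linarith)
    have hzp : 0 < N z ^ p := by positivity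
    have h6 := (mul_le_mul_of_nonneg_left hbern hzp.le).trans hB2
    have e7 : N z ^ p * (1 + p * (c * t ^ 2 * (Δ / a) / N z)) = N z ^ p + t ^ 2 * K := by
      rw [hK]; ring
    have e8 : t ^ p = t ^ 2 * t ^ (p - 2) := by
      rw [← Real.rpow_natCast t 2, ← Real.rpow_add ht]; congr 1; push_cast; ring
    rw [e7, e8] at h6
    have h9 : t ^ 2 * K ≤ t ^ 2 * (t ^ (p - 2) * C) := by linarith
    exact le_of_mul_le_mul_left h9 (by positivity)
  have hlim : Filter.Tendsto (fun t : ℝ => t ^ (p - 2) * C) (nhdsWithin 0 (Set.Ioi 0)) (nhds 0) := by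
    have : Continuous (fun t : ℝ => t ^ (p - 2) * C) :=
      (Real.continuous_rpow_const (by linarith)).mul continuous_const
    have h := this.tendsto 0
    simp only [Real.zero_rpow (by linarith : p - 2 ≠ 0), zero_mul] at h
    exact h.mono_left nhdsWithin_le_nhds
  have : K ≤ 0 := by
    apply ge_of_tendsto hlim
    filter_upwards [Ioc_mem_nhdsGT (zero_lt_one (α := ℝ))] with t ht
    exact hfin t ht.1 ht.2
  linarith

lemma aux_upper (d : ℕ) (N : (Fin d → ℝ) → ℝ)
    (hsmul : ∀ (c : ℝ) (x), N (c • x) = |c| * N x)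
    (huncond : ∀ x y : Fin d → ℝ, (∀ i, |x i| ≤ |y i|) → N x ≤ N y)
    (p : ℝ) (hp : 2 < p)
    (hpconv : ∀ (m : ℕ) (xs : Fin m → (Fin d → ℝ)),
      N (fun i => (∑ j, |xs j i| ^ p) ^ (1 / p)) ≤
        (∑ j, N (xs j) ^ p) ^ (1 / p))
    (z y v : Fin d → ℝ) (hzy : ∀ i, z i = 0 ∨ y i = 0) (t : ℝ) (ht : 0 < t)
    (hv : ∀ i, |v i| = |z i| + t * |y i|) :
    N v ^ p ≤ N z ^ p + t ^ p * N y ^ p := by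
  have hp0 : 0 < p := by linarith
  have hN0 : N 0 = 0 := by have := hsmul 0 0; simpa using this
  have hNn : ∀ x, 0 ≤ N x := fun x => by
    rw [← hN0]; exact huncond _ _ (by simp)
  have hc := hpconv 2 ![z, t • y]
  simp only [Fin.sum_univ_two, Matrix.cons_val_zero, Matrix.cons_val_one,
    Pi.smul_apply, smul_eq_mul] at hc
  have hk : N v ≤ N (fun i => (|z i| ^ p + |t * y i| ^ p) ^ (1 / p)) := by
    apply huncond
    intro i
    rw [hv i, abs_of_nonneg (a := (_ : ℝ) ^ (1 / p)) (by positivity)]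
    rcases hzy i with h | h
    · simp only [h, abs_zero, Real.zero_rpow hp0.ne', zero_add]
      rw [one_div, Real.rpow_rpow_inv (abs_nonneg _) hp0.ne', abs_mul, abs_of_pos ht]
    · simp only [h, abs_zero, Real.zero_rpow hp0.ne', mul_zero, add_zero]
      rw [one_div, Real.rpow_rpow_inv (abs_nonneg _) hp0.ne']
  have hk3 := Real.rpow_le_rpow (hNn _) (hk.trans hc) hp0.le
  have p1 := Real.rpow_nonneg (hNn z) p
  have p2 := Real.rpow_nonneg (hNn (t • y)) p
  rw [one_div, Real.rpow_inv_rpow (by linarith) hp0.ne', hsmul, abs_of_pos ht,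
    Real.mul_rpow ht.le (hNn y)] at hk3
  exact hk3

theorem stmt14 (d : ℕ) (hd : 3 ≤ d)
    (NX NY : (Fin d → ℝ) → ℝ)
    (hNX_add : ∀ x y, NX (x + y) ≤ NX x + NX y)
    (hNX_smul : ∀ (c : ℝ) (x), NX (c • x) = |c| * NX x)
    (hNX_def : ∀ x, NX x = 0 → x = 0)
    (hNY_add : ∀ x y, NY (x + y) ≤ NY x + NY y)
    (hNY_smul : ∀ (c : ℝ) (x), NY (c • x) = |c| * NY x)
    (hNY_def : ∀ x, NY x = 0 → x = 0)
    (hNX_uncond : ∀ x y : Fin d → ℝ, (∀ i, |x i| ≤ |y i|) → NX x ≤ NX y)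
    (hNY_uncond : ∀ x y : Fin d → ℝ, (∀ i, |x i| ≤ |y i|) → NY x ≤ NY y)
    (hNX_strict : ∀ x y : Fin d → ℝ, (∀ i, |x i| ≤ |y i|) →
      (∃ i, |x i| < |y i|) → NX x < NX y)
    (hNY_strict : ∀ x y : Fin d → ℝ, (∀ i, |x i| ≤ |y i|) →
      (∃ i, |x i| < |y i|) → NY x < NY y)
    (p : ℝ) (hp : 2 < p)
    (hNX_pconv : ∀ (m : ℕ) (xs : Fin m → (Fin d → ℝ)),
      NX (fun i => (∑ j, |xs j i| ^ p) ^ (1 / p)) ≤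
        (∑ j, NX (xs j) ^ p) ^ (1 / p))
    (hNY_pconv : ∀ (m : ℕ) (xs : Fin m → (Fin d → ℝ)),
      NY (fun i => (∑ j, |xs j i| ^ p) ^ (1 / p)) ≤
        (∑ j, NY (xs j) ^ p) ^ (1 / p))
    (U : (Fin d → ℝ) →ₗ[ℝ] (Fin d → ℝ))
    (hU_surj : Function.Surjective U)
    (hU_isom : ∀ x, NY (U x) = NX x)
    (k l : Fin d) (hkl : k ≠ l)
    (g h : (Fin d → ℝ) →ₗ[ℝ] ℝ) (hg : g ≠ 0) (hh : h ≠ 0)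
    (hUk : Submodule.map U (LinearMap.ker (LinearMap.proj k :
      (Fin d → ℝ) →ₗ[ℝ] ℝ)) = LinearMap.ker g)
    (hUl : Submodule.map U (LinearMap.ker (LinearMap.proj l :
      (Fin d → ℝ) →ₗ[ℝ] ℝ)) = LinearMap.ker h)
    (hg_card : {ν : Fin d | g ((Pi.single ν 1 : Fin d → ℝ)) ≠ 0}.ncard = 2)
    (hgh : ({ν : Fin d | h ((Pi.single ν 1 : Fin d → ℝ)) ≠ 0} ∩
      {ν : Fin d | g ((Pi.single ν 1 : Fin d → ℝ)) ≠ 0}).Nonempty) :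
    {ν : Fin d | h ((Pi.single ν 1 : Fin d → ℝ)) ≠ 0} ⊆
      {ν : Fin d | g ((Pi.single ν 1 : Fin d → ℝ)) ≠ 0} := by
  exfalso
  have hdis : ∀ a b : Fin d, a ≠ b → ∀ i,
      U (Pi.single a 1) i = 0 ∨ U (Pi.single b 1) i = 0 := by
    intro a b hab i
    have hxy : ∀ i, (Pi.single a 1 : Fin d → ℝ) i = 0 ∨ (Pi.single b 1 : Fin d → ℝ) i = 0 := by
      intro i
      by_cases h : i = a
      · right; subst h; simp [hab]
      · left; simp [h]
    refine aux_disj d NY hNY_add hNY_smul hNY_uncond hNY_strict p hp hNY_pconv _ _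
      (NX (Pi.single b 1) ^ p) ?_ ?_ i
    · intro t ht
      rw [← map_smul, ← map_add, hU_isom, hU_isom]
      refine aux_upper d NX hNX_smul hNX_uncond p hp hNX_pconv _ _ _ hxy t ht ?_
      intro i
      rcases hxy i with h | h <;> simp [h, abs_mul, abs_of_pos ht]
    · intro t ht
      rw [← map_smul, ← map_sub, hU_isom, hU_isom]
      refine aux_upper d NX hNX_smul hNX_uncond p hp hNX_pconv _ _ _ hxy t ht ?_
      intro i
      rcases hxy i with h | h <;> simp [h, abs_mul, abs_of_pos ht]
  have hinj : Function.Injective U := LinearMap.injective_iff_surjective.2 hU_surj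
  have hne : ∀ a : Fin d, ∃ i, U (Pi.single a 1) i ≠ 0 := by
    intro a
    by_contra hcon
    push Not at hcon
    have h0 : U (Pi.single a 1) = U 0 := by rw [map_zero]; exact funext hcon
    have h1 := congrFun (hinj h0) a
    simp at h1
  choose σ hσ using hne
  have hσinj : Function.Injective σ := by
    intro a b hab
    by_contra hn
    rcases hdis a b hn (σ a) with h | h
    · exact hσ a h
    · rw [hab] at h; exact hσ b h
  have hσsurj : Function.Surjective σ := Finite.injective_iff_surjective.1 hσinj
  have hsub : {ν : Fin d | g ((Pi.single ν 1 : Fin d → ℝ)) ≠ 0} ⊆ {σ k} := by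
    intro ν hν
    obtain ⟨j, rfl⟩ := hσsurj ν
    by_contra hn
    have hjk : j ≠ k := fun e => hn (by simp [e])
    have hUj : U (Pi.single j 1) = U (Pi.single j 1) (σ j) • (Pi.single (σ j) 1 : Fin d → ℝ) := by
      funext i
      by_cases hi : i = σ j
      · subst hi; simp
      · obtain ⟨m, rfl⟩ := hσsurj i
        have hmj : j ≠ m := fun e => hi (by rw [e])
        rcases hdis j m hmj (σ m) with h | h
        · rw [h]; simp [hi]
        · exact absurd h (hσ m)
    have hmem : U (Pi.single j 1) ∈ LinearMap.ker g := by
      rw [← hUk]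
      exact Submodule.mem_map_of_mem (by simp [hjk.symm])
    rw [LinearMap.mem_ker, hUj, map_smul, smul_eq_mul] at hmem
    rcases mul_eq_zero.1 hmem with h | h
    · exact hσ j h
    · exact hν h
  have := Set.ncard_le_ncard hsub
  rw [hg_card, Set.ncard_singleton] at this
  omega
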